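/- Let $K$ be any field, $n\geq 4$, and $i_1\geq 1$ an integer. Then the Chein automorphism $C(3y_1^{i_1}y_n)=(x_1+[x_2,x_3]\,3y_1^{i_1}y_n,\ x_2,\ldots,x_n)$ of $M_n$ is tame, where $3$ denotes $3\cdot 1_K$. -/

import Mathlib

noncomputable section

/-- The free metabelian Lie algebra of rank `n` over `K`: the quotient of the free Lie
algebra on `n` generators by its second derived ideal. -/
abbrev FreeMetabelianLie (K : Type) [Field K] (n : ℕ) : Type :=
  FreeLieAlgebra K (Fin n) ⧸ LieAlgebra.derivedSeries K (FreeLieAlgebra K (Fin n)) 2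

/-- The free generators `x₁, …, xₙ` of the free metabelian Lie algebra. -/
def xg (K : Type) [Field K] (n : ℕ) (i : Fin n) : FreeMetabelianLie K n :=
  LieSubmodule.Quotient.mk (N := LieAlgebra.derivedSeries K (FreeLieAlgebra K (Fin n)) 2)
    (FreeLieAlgebra.of K i)

/-- The group structure on Lie algebra automorphisms, with `(e * f) x = e (f x)`. -/
instance lieAutGroup (K : Type) [CommRing K] (L : Type) [LieRing L] [LieAlgebra K L] :
    Group (L ≃ₗ⁅K⁆ L) where
  mul e f := f.trans e
  one := LieEquiv.refl
  inv := LieEquiv.symm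
  mul_assoc _ _ _ := LieEquiv.ext fun _ => rfl
  one_mul _ := LieEquiv.ext fun _ => rfl
  mul_one _ := LieEquiv.ext fun _ => rfl
  inv_mul_cancel e := LieEquiv.ext fun x => e.symm_apply_apply x

/-- An automorphism of the free metabelian Lie algebra is elementary if it maps some `xᵢ` to
`α • xᵢ + f`, with `0 ≠ α ∈ K` and `f` in the subalgebra generated by the other generators,
and fixes all other generators. -/
def IsElementaryAut (K : Type) [Field K] (n : ℕ)
    (φ : FreeMetabelianLie K n ≃ₗ⁅K⁆ FreeMetabelianLie K n) : Prop :=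
  ∃ (i : Fin n) (α : K) (f : FreeMetabelianLie K n), α ≠ 0 ∧
    f ∈ LieSubalgebra.lieSpan K (FreeMetabelianLie K n) (xg K n '' {j | j ≠ i}) ∧
    φ (xg K n i) = α • xg K n i + f ∧ ∀ j : Fin n, j ≠ i → φ (xg K n j) = xg K n j

/-- A tame automorphism is one in the subgroup generated by the elementary automorphisms. -/
def IsTame (K : Type) [Field K] (n : ℕ)
    (φ : FreeMetabelianLie K n ≃ₗ⁅K⁆ FreeMetabelianLie K n) : Prop :=
  φ ∈ Subgroup.closure {ψ | IsElementaryAut K n ψ}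

/-- A Chein automorphism (one-row transformation) moves only one generator. -/
def IsCheinAut (K : Type) [Field K] (n : ℕ)
    (φ : FreeMetabelianLie K n ≃ₗ⁅K⁆ FreeMetabelianLie K n) : Prop :=
  ∃ i : Fin n, ∀ j : Fin n, j ≠ i → φ (xg K n j) = xg K n j

/-- An almost tame automorphism is one in the subgroup generated by Chein automorphisms. -/
def IsAlmostTame (K : Type) [Field K] (n : ℕ)
    (φ : FreeMetabelianLie K n ≃ₗ⁅K⁆ FreeMetabelianLie K n) : Prop :=
  φ ∈ Subgroup.closure {ψ | IsCheinAut K n ψ}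

/-- `monoSet K n k` is the set of right-normed Lie monomials of degree `k+1` in the
generators. -/
def monoSet (K : Type) [Field K] (n : ℕ) : ℕ → Set (FreeMetabelianLie K n)
  | 0 => Set.range (xg K n)
  | k + 1 => {z | ∃ u ∈ monoSet K n k, ∃ i : Fin n, z = ⁅u, xg K n i⁆}

/-- `gradePiece K n k` (for `k ≥ 1`) is the homogeneous component `L_k` of the standard
grading: the linear span of the Lie monomials of degree `k` in the generators. -/
def gradePiece (K : Type) [Field K] (n : ℕ) (k : ℕ) : Submodule K (FreeMetabelianLie K n) :=
  Submodule.span K (monoSet K n (k - 1))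

/-- The automorphism `φ = (l₁ + m₁, …, lₙ + mₙ)` (with `lᵢ` linear, `mᵢ ∈ [M,M]`) has lower
degree `≥ d`: each `φ(xᵢ)` lies in `L₁ ⊕ (⨆ k ≥ d, L_k)`. -/
def AutLdegGE (K : Type) [Field K] (n : ℕ)
    (φ : FreeMetabelianLie K n ≃ₗ⁅K⁆ FreeMetabelianLie K n) (d : ℕ) : Prop :=
  ∀ i : Fin n, φ (xg K n i) ∈
    gradePiece K n 1 ⊔ ⨆ (k : ℕ) (_ : d ≤ k), gradePiece K n k

/-- The action of a polynomial `a ∈ U = K[y₁,…,yₙ]` on `m`; for `m ∈ [M,M]` this is the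
canonical `U`-module action on the derived ideal, determined by `m ⬝ yᵢ = ⁅m, xᵢ⁆`. -/
def polyAct (K : Type) [Field K] (n : ℕ) (a : MvPolynomial (Fin n) K)
    (m : FreeMetabelianLie K n) : FreeMetabelianLie K n :=
  ∑ d ∈ a.support, a.coeff d •
    ((List.ofFn fun i : Fin n =>
      (-(LieAlgebra.ad K (FreeMetabelianLie K n) (xg K n i))) ^ (d i)).prod m)

/-- The polynomial `a` has lower degree `≥ d`: every monomial of `a` has total degree `≥ d`. -/
def PolyLdegGE (K : Type) [Field K] (n : ℕ) (a : MvPolynomial (Fin n) K) (d : ℕ) : Prop :=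
  ∀ v ∈ a.support, d ≤ ∑ i, v i

/-- An exponential automorphism: `exp (ad z) = id + ad z` for some `z ∈ [M,M]`. -/
def IsExponentialAut (K : Type) [Field K] (n : ℕ)
    (φ : FreeMetabelianLie K n ≃ₗ⁅K⁆ FreeMetabelianLie K n) : Prop :=
  ∃ z ∈ LieAlgebra.derivedSeries K (FreeMetabelianLie K n) 1,
    ∀ m : FreeMetabelianLie K n, φ m = m + ⁅z, m⁆

end

noncomputable section

namespace FreeMetabelianLie

variable {K : Type} [Field K] {n : ℕ}

/-- The projection of the free Lie algebra onto the free metabelian Lie algebra. -/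
def proj (K : Type) [Field K] (n : ℕ) :
    FreeLieAlgebra K (Fin n) →ₗ⁅K⁆ FreeMetabelianLie K n :=
  { (LieAlgebra.derivedSeries K (FreeLieAlgebra K (Fin n)) 2).toSubmodule.mkQ with
    map_lie' := fun {_ _} => rfl }

theorem proj_surjective : Function.Surjective (proj K n) := Quot.mk_surjective

theorem derivedSeries_two_eq_bot :
    LieAlgebra.derivedSeries K (FreeMetabelianLie K n) 2 = ⊥ := by
  rw [← LieIdeal.derivedSeries_map_eq 2 (proj_surjective (K := K) (n := n)),
    LieIdeal.map_eq_bot_iff]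
  intro x hx
  exact LieHom.mem_ker.2 ((Submodule.Quotient.mk_eq_zero _).2 hx)

theorem lie_mem_derived (a b : FreeMetabelianLie K n) :
    ⁅a, b⁆ ∈ LieAlgebra.derivedSeries K (FreeMetabelianLie K n) 1 := by
  change _ ∈ LieAlgebra.derivedSeriesOfIdeal K (FreeMetabelianLie K n) (0 + 1) ⊤
  rw [LieAlgebra.derivedSeriesOfIdeal_succ, LieAlgebra.derivedSeriesOfIdeal_zero]
  exact LieSubmodule.lie_mem_lie (LieSubmodule.mem_top a) (LieSubmodule.mem_top b)

theorem lie_eq_zero_of_mem_derived {a b : FreeMetabelianLie K n}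
    (ha : a ∈ LieAlgebra.derivedSeries K (FreeMetabelianLie K n) 1)
    (hb : b ∈ LieAlgebra.derivedSeries K (FreeMetabelianLie K n) 1) : ⁅a, b⁆ = 0 := by
  rw [← LieSubmodule.mem_bot (R := K) (L := FreeMetabelianLie K n),
    ← derivedSeries_two_eq_bot]
  change _ ∈ LieAlgebra.derivedSeriesOfIdeal K (FreeMetabelianLie K n) (1 + 1) ⊤
  rw [LieAlgebra.derivedSeriesOfIdeal_succ]
  exact LieSubmodule.lie_mem_lie ha hb

/-- The endomorphism of the free metabelian Lie algebra with prescribed values on the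
generators. -/
def lift (f : Fin n → FreeMetabelianLie K n) :
    FreeMetabelianLie K n →ₗ⁅K⁆ FreeMetabelianLie K n :=
  { (LieAlgebra.derivedSeries K (FreeLieAlgebra K (Fin n)) 2).toSubmodule.liftQ
      (FreeLieAlgebra.lift K f : FreeLieAlgebra K (Fin n) →ₗ[K] FreeMetabelianLie K n)
      (fun x hx => by
        have h := LieIdeal.derivedSeries_map_le (f := FreeLieAlgebra.lift K f) 2
          (LieIdeal.mem_map hx)
        rw [derivedSeries_two_eq_bot] at h
        exact h) with
    map_lie' := fun {a b} => by
      obtain ⟨a, rfl⟩ := proj_surjective a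
      obtain ⟨b, rfl⟩ := proj_surjective b
      exact LieHom.map_lie (FreeLieAlgebra.lift K f) a b }

theorem lift_xg (f : Fin n → FreeMetabelianLie K n) (i : Fin n) :
    lift f (xg K n i) = f i :=
  FreeLieAlgebra.lift_of_apply f i

theorem hom_ext {f g : FreeMetabelianLie K n →ₗ⁅K⁆ FreeMetabelianLie K n}
    (h : ∀ i, f (xg K n i) = g (xg K n i)) : f = g := by
  have hp : f.comp (proj K n) = g.comp (proj K n) := FreeLieAlgebra.hom_ext h
  ext x
  obtain ⟨x, rfl⟩ := proj_surjective x
  exact LieHom.congr_fun hp x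

theorem equiv_ext {φ ψ : FreeMetabelianLie K n ≃ₗ⁅K⁆ FreeMetabelianLie K n}
    (h : ∀ i, φ (xg K n i) = ψ (xg K n i)) : φ = ψ :=
  LieEquiv.ext fun x => LieHom.congr_fun (hom_ext (f := φ.toLieHom) (g := ψ.toLieHom) h) x

/-- The subalgebra generated by the generators other than `xᵢ`. -/
abbrev others (K : Type) [Field K] (n : ℕ) (i : Fin n) :
    LieSubalgebra K (FreeMetabelianLie K n) :=
  LieSubalgebra.lieSpan K (FreeMetabelianLie K n) (xg K n '' {j | j ≠ i})

theorem xg_mem_others {i j : Fin n} (h : j ≠ i) : xg K n j ∈ others K n i :=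
  LieSubalgebra.subset_lieSpan ⟨j, h, rfl⟩

theorem apply_eq_self_of_mem_others {i : Fin n}
    {ψ : FreeMetabelianLie K n →ₗ⁅K⁆ FreeMetabelianLie K n}
    (hψ : ∀ j, j ≠ i → ψ (xg K n j) = xg K n j) {f : FreeMetabelianLie K n}
    (hf : f ∈ others K n i) : ψ f = f := by
  induction hf using LieSubalgebra.lieSpan_induction with
  | mem x h => obtain ⟨j, hj, rfl⟩ := h; exact hψ j hj
  | zero => exact map_zero ψ
  | add x y _ _ hx hy => rw [map_add, hx, hy]
  | smul a x _ hx => rw [map_smul, hx]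
  | lie x y _ _ hx hy => rw [LieHom.map_lie, hx, hy]

theorem mul_apply (φ ψ : FreeMetabelianLie K n ≃ₗ⁅K⁆ FreeMetabelianLie K n)
    (x : FreeMetabelianLie K n) : (φ * ψ) x = φ (ψ x) := rfl

theorem inv_apply_self (φ : FreeMetabelianLie K n ≃ₗ⁅K⁆ FreeMetabelianLie K n)
    (x : FreeMetabelianLie K n) : φ⁻¹ (φ x) = x := φ.symm_apply_apply x

theorem inv_apply_eq {φ : FreeMetabelianLie K n ≃ₗ⁅K⁆ FreeMetabelianLie K n}
    {x y : FreeMetabelianLie K n} (h : φ y = x) : φ⁻¹ x = y := by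
  rw [← h, inv_apply_self]

theorem exists_transvection {i : Fin n} {f : FreeMetabelianLie K n} (hf : f ∈ others K n i) :
    ∃ ψ : FreeMetabelianLie K n ≃ₗ⁅K⁆ FreeMetabelianLie K n, IsTame K n ψ ∧
      ψ (xg K n i) = xg K n i + f ∧ ∀ j, j ≠ i → ψ (xg K n j) = xg K n j := by
  let F (g : FreeMetabelianLie K n) := lift (Function.update (xg K n) i (xg K n i + g))
  have Fi (g) : F g (xg K n i) = xg K n i + g := by simp [F, lift_xg]
  have Fj (g) (j) (h : j ≠ i) : F g (xg K n j) = xg K n j := by simp [F, lift_xg, h]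
  have hcomp (g) (hg : g ∈ others K n i) : (F (-g)).comp (F g) = LieHom.id := by
    refine hom_ext fun j => ?_
    by_cases h : j = i
    · subst h
      simp [Fi, apply_eq_self_of_mem_others (Fj (-g)) hg]
    · simp [Fj _ _ h]
  have h1 := hcomp f hf
  have h2 := hcomp (-f) (neg_mem hf)
  rw [neg_neg] at h2
  let ψ : FreeMetabelianLie K n ≃ₗ⁅K⁆ FreeMetabelianLie K n :=
    { F f with
      invFun := F (-f)
      left_inv := fun x => LieHom.congr_fun h1 x
      right_inv := fun x => LieHom.congr_fun h2 x }
  refine ⟨ψ, Subgroup.subset_closure ⟨i, 1, f, one_ne_zero, hf, ?_, Fj f⟩, Fi f, Fj f⟩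
  rw [one_smul]
  exact Fi f

/-- The elements of the derived ideal fixed by every automorphism which fixes all generators
other than `xᵢ` and moves `xᵢ` by an element of the derived ideal. -/
def cheinFixed (K : Type) [Field K] (n : ℕ) (i : Fin n) :
    Submodule K (FreeMetabelianLie K n) where
  carrier := {m | m ∈ LieAlgebra.derivedSeries K (FreeMetabelianLie K n) 1 ∧
    ∀ ψ : FreeMetabelianLie K n ≃ₗ⁅K⁆ FreeMetabelianLie K n,
      ψ (xg K n i) - xg K n i ∈ LieAlgebra.derivedSeries K (FreeMetabelianLie K n) 1 →
      (∀ j, j ≠ i → ψ (xg K n j) = xg K n j) → ψ m = m}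
  add_mem' := fun ha hb => ⟨add_mem ha.1 hb.1, fun ψ h h' => by
    rw [map_add, ha.2 ψ h h', hb.2 ψ h h']⟩
  zero_mem' := ⟨zero_mem _, fun ψ _ _ => map_zero ψ⟩
  smul_mem' := fun c _ ha => ⟨Submodule.smul_mem _ c ha.1, fun ψ h h' => by
    rw [map_smul, ha.2 ψ h h']⟩

theorem lie_mem_cheinFixed {i a b : Fin n} (ha : a ≠ i) (hb : b ≠ i) :
    ⁅xg K n a, xg K n b⁆ ∈ cheinFixed K n i :=
  ⟨lie_mem_derived _ _, fun ψ _ h => by rw [LieEquiv.map_lie, h a ha, h b hb]⟩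

theorem lie_xg_mem_cheinFixed {i : Fin n} {m : FreeMetabelianLie K n}
    (hm : m ∈ cheinFixed K n i) (j : Fin n) : ⁅m, xg K n j⁆ ∈ cheinFixed K n i := by
  refine ⟨lie_mem_derived _ _, fun ψ h h' => ?_⟩
  rw [LieEquiv.map_lie, hm.2 ψ h h']
  by_cases hj : j = i
  · subst hj
    rw [← sub_eq_zero, ← lie_sub]
    exact lie_eq_zero_of_mem_derived hm.1 h
  · rw [h' j hj]

/-- The elements `f` for which `(x₁, …, xᵢ + f, …, xₙ)` is a tame automorphism, `f` being as
in `cheinFixed`. -/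
def tameChein (K : Type) [Field K] (n : ℕ) (i : Fin n) :
    AddSubgroup (FreeMetabelianLie K n) where
  carrier := {f | f ∈ cheinFixed K n i ∧
    ∃ ψ : FreeMetabelianLie K n ≃ₗ⁅K⁆ FreeMetabelianLie K n, IsTame K n ψ ∧
      ψ (xg K n i) = xg K n i + f ∧ ∀ j, j ≠ i → ψ (xg K n j) = xg K n j}
  add_mem' := by
    rintro f g ⟨hf, φ, hφ, hφi, hφj⟩ ⟨hg, ψ, hψ, hψi, hψj⟩
    refine ⟨add_mem hf hg, φ * ψ, mul_mem hφ hψ, ?_, fun j hj => ?_⟩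
    · rw [mul_apply, hψi, map_add, hφi, hg.2 φ (by simpa [hφi] using hf.1) hφj, add_assoc]
    · rw [mul_apply, hψj j hj, hφj j hj]
  zero_mem' := ⟨zero_mem _, 1, one_mem (Subgroup.closure _), (add_zero _).symm, fun _ _ => rfl⟩
  neg_mem' := by
    rintro f ⟨hf, φ, hφ, hφi, hφj⟩
    refine ⟨neg_mem hf, φ⁻¹, inv_mem hφ, inv_apply_eq ?_, fun j hj => inv_apply_eq (hφj j hj)⟩
    rw [map_add, map_neg, hφi, hf.2 φ (by simpa [hφi] using hf.1) hφj, add_neg_cancel_right]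

/-- The linear operator `m ↦ m ⬝ yᵢ = ⁅m, xᵢ⁆`. -/
def rad (K : Type) [Field K] (n : ℕ) (i : Fin n) : Module.End K (FreeMetabelianLie K n) :=
  -(LieAlgebra.ad K (FreeMetabelianLie K n) (xg K n i))

theorem rad_apply (i : Fin n) (m : FreeMetabelianLie K n) : rad K n i m = ⁅m, xg K n i⁆ := by
  simp [rad]

theorem rad_pow_succ_apply (i : Fin n) (e : ℕ) (m : FreeMetabelianLie K n) :
    (rad K n i ^ (e + 1)) m = ⁅(rad K n i ^ e) m, xg K n i⁆ := by
  rw [pow_succ', Module.End.mul_apply, rad_apply]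

theorem lie_right_comm_of_mem_derived {m : FreeMetabelianLie K n}
    (hm : m ∈ LieAlgebra.derivedSeries K (FreeMetabelianLie K n) 1)
    (a b : FreeMetabelianLie K n) : ⁅⁅m, a⁆, b⁆ = ⁅⁅m, b⁆, a⁆ := by
  have h := leibniz_lie m a b
  rw [lie_eq_zero_of_mem_derived hm (lie_mem_derived a b), ← lie_skew a] at h
  exact sub_eq_zero.1 (by rw [sub_eq_add_neg, ← h])

theorem rad_pow_mem_derived (i : Fin n) (e : ℕ) {m : FreeMetabelianLie K n}
    (hm : m ∈ LieAlgebra.derivedSeries K (FreeMetabelianLie K n) 1) :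
    (rad K n i ^ e) m ∈ LieAlgebra.derivedSeries K (FreeMetabelianLie K n) 1 := by
  cases e with
  | zero => simpa using hm
  | succ e => rw [rad_pow_succ_apply]; exact lie_mem_derived _ _

theorem rad_pow_lie (i : Fin n) (e : ℕ) {m : FreeMetabelianLie K n}
    (hm : m ∈ LieAlgebra.derivedSeries K (FreeMetabelianLie K n) 1)
    (a : FreeMetabelianLie K n) : (rad K n i ^ e) ⁅m, a⁆ = ⁅(rad K n i ^ e) m, a⁆ := by
  induction e with
  | zero => simp
  | succ e ih =>
    rw [rad_pow_succ_apply, ih, rad_pow_succ_apply,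
      lie_right_comm_of_mem_derived (rad_pow_mem_derived i e hm)]

theorem rad_pow_mem_cheinFixed {i : Fin n} (e : ℕ) {m : FreeMetabelianLie K n}
    (hm : m ∈ cheinFixed K n i) : (rad K n i ^ e) m ∈ cheinFixed K n i := by
  induction e with
  | zero => simpa using hm
  | succ e ih => rw [rad_pow_succ_apply]; exact lie_xg_mem_cheinFixed ih i

theorem rad_pow_mem_others {i c : Fin n} (hic : i ≠ c) (e : ℕ) {m : FreeMetabelianLie K n}
    (hm : m ∈ others K n c) : (rad K n i ^ e) m ∈ others K n c := by
  induction e with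
  | zero => simpa using hm
  | succ e ih => rw [rad_pow_succ_apply]; exact LieSubalgebra.lie_mem _ ih (xg_mem_others hic)

theorem map_rad_pow {i : Fin n} (e : ℕ)
    {ψ : FreeMetabelianLie K n ≃ₗ⁅K⁆ FreeMetabelianLie K n} (h : ψ (xg K n i) = xg K n i)
    (m : FreeMetabelianLie K n) : ψ ((rad K n i ^ e) m) = (rad K n i ^ e) (ψ m) := by
  induction e with
  | zero => simp
  | succ e ih => rw [rad_pow_succ_apply, LieEquiv.map_lie, ih, h, rad_pow_succ_apply]

theorem rad_pow_mem_cheinFixed_of_ne {i a b c : Fin n} (e : ℕ) (ha : a ≠ i) (hb : b ≠ i) :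
    (rad K n i ^ e) ⁅⁅xg K n a, xg K n b⁆, xg K n c⁆ ∈ cheinFixed K n i :=
  rad_pow_mem_cheinFixed e (lie_xg_mem_cheinFixed (lie_mem_cheinFixed ha hb) c)

theorem rad_pow_self_mem_tameChein {i a b c : Fin n} (e : ℕ) (ha : a ≠ i) (hb : b ≠ i)
    (hc : c ≠ i) (hac : a ≠ c) (hbc : b ≠ c) :
    (rad K n i ^ e) ⁅⁅xg K n a, xg K n b⁆, xg K n a⁆ ∈ tameChein K n i := by
  refine ⟨rad_pow_mem_cheinFixed_of_ne e ha hb, ?_⟩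
  rw [rad_pow_lie i e (lie_mem_derived _ _)]
  set g := (rad K n i ^ e) ⁅xg K n a, xg K n b⁆ with hg
  have hgF : g ∈ cheinFixed K n i := rad_pow_mem_cheinFixed e (lie_mem_cheinFixed ha hb)
  have hgc : g ∈ others K n c := rad_pow_mem_others hc.symm e
    (LieSubalgebra.lie_mem _ (xg_mem_others hac) (xg_mem_others hbc))
  obtain ⟨A, hA, hAi, hAj⟩ := exists_transvection (K := K) (i := i)
    (LieSubalgebra.lie_mem _ (xg_mem_others hc) (xg_mem_others ha))
  obtain ⟨B, hB, hBc, hBj⟩ := exists_transvection hgc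
  have hAg : A g = g := hgF.2 A (by simpa [hAi] using lie_mem_derived _ _) hAj
  have hBg : B g = g := apply_eq_self_of_mem_others (ψ := B.toLieHom) hBj hgc
  have hA'i : A⁻¹ (xg K n i) = xg K n i - ⁅xg K n c, xg K n a⁆ := inv_apply_eq (by
    rw [map_sub, LieEquiv.map_lie, hAi, hAj c hc, hAj a ha, add_sub_cancel_right])
  have hA'j (j) (hj : j ≠ i) : A⁻¹ (xg K n j) = xg K n j := inv_apply_eq (hAj j hj)
  have hB'c : B⁻¹ (xg K n c) = xg K n c - g := inv_apply_eq (by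
    rw [map_sub, hBc, hBg, add_sub_cancel_right])
  have hB'j (j) (hj : j ≠ c) : B⁻¹ (xg K n j) = xg K n j := inv_apply_eq (hBj j hj)
  refine ⟨B * A * B⁻¹ * A⁻¹, mul_mem (mul_mem (mul_mem hB hA) (inv_mem hB)) (inv_mem hA),
    ?_, fun j hj => ?_⟩
  · simp only [mul_apply, hA'i, map_sub, map_add, LieEquiv.map_lie, hB'j i hc.symm, hB'c,
      hB'j a hac, hAi, hAj c hc, hAj a ha, hAg, hBc, hBj i hc.symm, hBj a hac, hBg, sub_lie,
      add_lie]
    abel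
  · by_cases hjc : j = c
    · subst hjc
      simp only [mul_apply, hA'j j hj, hB'c, map_sub, hAj j hj, hAg, hBc, hBg,
        add_sub_cancel_right]
    · simp only [mul_apply, hA'j j hj, hB'j j hjc, hAj j hj, hBj j hjc]

theorem rad_pow_add_mem_tameChein {i a b c : Fin n} (e : ℕ) (ha : a ≠ i) (hb : b ≠ i)
    (hc : c ≠ i) (hab : a ≠ b) (hac : a ≠ c) (hbc : b ≠ c) :
    (rad K n i ^ e) ⁅⁅xg K n a, xg K n b⁆, xg K n c⁆ +
      (rad K n i ^ e) ⁅⁅xg K n c, xg K n b⁆, xg K n a⁆ ∈ tameChein K n i := by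
  have haa := rad_pow_self_mem_tameChein (K := K) e ha hb hc hac hbc
  have hcc := rad_pow_self_mem_tameChein (K := K) e hc hb ha hac.symm hab.symm
  have hsum : (rad K n i ^ e) ⁅⁅xg K n a + xg K n c, xg K n b⁆, xg K n a + xg K n c⁆ =
      (rad K n i ^ e) ⁅⁅xg K n a, xg K n b⁆, xg K n a⁆ +
      (rad K n i ^ e) ⁅⁅xg K n c, xg K n b⁆, xg K n c⁆ +
      ((rad K n i ^ e) ⁅⁅xg K n a, xg K n b⁆, xg K n c⁆ +
      (rad K n i ^ e) ⁅⁅xg K n c, xg K n b⁆, xg K n a⁆) := by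
    simp only [add_lie, lie_add, map_add]
    abel
  suffices h : (rad K n i ^ e) ⁅⁅xg K n a + xg K n c, xg K n b⁆, xg K n a + xg K n c⁆ ∈
      tameChein K n i by
    rw [hsum] at h
    exact (AddSubgroup.add_mem_cancel_left _ (add_mem haa hcc)).1 h
  refine ⟨?_, ?_⟩
  · rw [hsum]
    exact add_mem (add_mem haa.1 hcc.1) (add_mem (rad_pow_mem_cheinFixed_of_ne e ha hb)
      (rad_pow_mem_cheinFixed_of_ne e hc hb))
  obtain ⟨_, ψ, hψ, hψi, hψj⟩ := haa
  obtain ⟨L, hL, hLa, hLj⟩ := exists_transvection (K := K) (xg_mem_others hac.symm)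
  have hL'a : L⁻¹ (xg K n a) = xg K n a - xg K n c := inv_apply_eq (by
    rw [map_sub, hLa, hLj c hac.symm, add_sub_cancel_right])
  have hL'j (j) (hj : j ≠ a) : L⁻¹ (xg K n j) = xg K n j := inv_apply_eq (hLj j hj)
  refine ⟨L * ψ * L⁻¹, mul_mem (mul_mem hL hψ) (inv_mem hL), ?_, fun j hj => ?_⟩
  · rw [mul_apply, mul_apply, hL'j i ha.symm, hψi, map_add, hLj i ha.symm,
      map_rad_pow e (hLj i ha.symm), LieEquiv.map_lie, LieEquiv.map_lie, hLa, hLj b hab.symm]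
  · by_cases hja : j = a
    · subst hja
      rw [mul_apply, mul_apply, hL'a, map_sub, map_sub, hψj j hj, hψj c hc, hLa,
        hLj c hac.symm, add_sub_cancel_right]
    · rw [mul_apply, mul_apply, hL'j j hja, hψj j hj, hLj j hja]

theorem three_smul_rad_pow_mem_tameChein {i a b c : Fin n} (e : ℕ) (ha : a ≠ i) (hb : b ≠ i)
    (hc : c ≠ i) (hab : a ≠ b) (hac : a ≠ c) (hbc : b ≠ c) :
    (3 : K) • (rad K n i ^ e) ⁅⁅xg K n a, xg K n b⁆, xg K n c⁆ ∈ tameChein K n i := by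
  have h1 := rad_pow_add_mem_tameChein (K := K) e ha hb hc hab hac hbc
  have h2 := rad_pow_add_mem_tameChein (K := K) e hb ha hc hab.symm hbc hac
  have hJ : ⁅⁅xg K n a, xg K n b⁆, xg K n c⁆ =
      ⁅⁅xg K n c, xg K n b⁆, xg K n a⁆ - ⁅⁅xg K n c, xg K n a⁆, xg K n b⁆ := by
    rw [← lie_skew _ (xg K n c), leibniz_lie (xg K n c), ← lie_skew _ ⁅xg K n c, xg K n b⁆]
    abel
  have hs : ⁅⁅xg K n b, xg K n a⁆, xg K n c⁆ = -⁅⁅xg K n a, xg K n b⁆, xg K n c⁆ := by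
    rw [← lie_skew (xg K n b), neg_lie]
  convert sub_mem h1 h2 using 1
  have hJ' := congrArg (rad K n i ^ e) hJ
  rw [map_sub] at hJ'
  rw [hs, map_neg, ← add_eq_of_eq_sub hJ']
  module

theorem polyAct_monomial (d : Fin n →₀ ℕ) (c : K) (m : FreeMetabelianLie K n) :
    polyAct K n (MvPolynomial.monomial d c) m =
      c • (List.ofFn fun i => rad K n i ^ d i).prod m := by
  classical
  by_cases hc : c = 0
  · simp [polyAct, hc]
  · rw [polyAct, MvPolynomial.support_monomial, if_neg hc, Finset.sum_singleton,
      MvPolynomial.coeff_monomial, if_pos rfl]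
    rfl

theorem prod_ofFn_pow_single_zero_add_single_last {R : Type*} [Monoid R] {k : ℕ}
    (r : Fin (k + 2) → R) (e : ℕ) :
    (List.ofFn fun i => r i ^
      (Finsupp.single 0 e + Finsupp.single (Fin.last (k + 1)) 1 : Fin (k + 2) →₀ ℕ) i).prod =
      r 0 ^ e * r (Fin.last (k + 1)) := by
  rw [List.ofFn_succ, List.ofFn_succ', List.prod_cons, List.prod_concat]
  have hmid : (fun j : Fin k => r j.castSucc.succ ^ (Finsupp.single 0 e +
      Finsupp.single (Fin.last (k + 1)) 1 : Fin (k + 2) →₀ ℕ) j.castSucc.succ) =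
      fun _ => 1 := by
    funext j
    have h : j.castSucc.succ ≠ Fin.last (k + 1) := by
      rw [Ne, ← Fin.succ_last, Fin.succ_inj]
      exact (Fin.castSucc_lt_last j).ne
    simp [h]
  rw [hmid, List.ofFn_const, List.prod_replicate, one_pow, one_mul]
  simp [Fin.last_eq_zero_iff]

end FreeMetabelianLie

end

open FreeMetabelianLie

open MvPolynomial in
/-- **Case 2 of Theorem 1 (`iₙ = 1`).** Over any field `K`, for `n ≥ 4` and `i₁ ≥ 1`, the
Chein automorphism `C(3 y₁^{i₁} yₙ) = (x₁ + [x₂,x₃] 3 y₁^{i₁} yₙ, x₂, …, xₙ)` of `Mₙ` is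
tame, where `3 = 3 ⋅ 1_K`. -/
theorem chein_three_y1_yn_is_tame (K : Type) [Field K] (n : ℕ) (hn : 4 ≤ n)
    (e1 : ℕ) (he1 : 1 ≤ e1)
    (i0 i1 i2 iN : Fin n)
    (h0 : (i0 : ℕ) = 0) (h1 : (i1 : ℕ) = 1) (h2 : (i2 : ℕ) = 2) (hN : (iN : ℕ) = n - 1)
    (φ : FreeMetabelianLie K n ≃ₗ⁅K⁆ FreeMetabelianLie K n)
    (hφ0 : φ (xg K n i0) = xg K n i0 +
      polyAct K n ((3 : MvPolynomial (Fin n) K) * X i0 ^ e1 * X iN) ⁅xg K n i1, xg K n i2⁆)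
    (hφ : ∀ j : Fin n, j ≠ i0 → φ (xg K n j) = xg K n j) :
    IsTame K n φ := by
  obtain ⟨k, rfl⟩ : ∃ k, n = k + 2 := ⟨n - 2, by omega⟩
  obtain rfl : i0 = 0 := Fin.ext h0
  obtain rfl : iN = Fin.last (k + 1) := Fin.ext hN
  have hne {a b : Fin (k + 2)} (h : (a : ℕ) ≠ b) : a ≠ b := fun h' => h (congrArg _ h')
  have hpoly : (3 : MvPolynomial (Fin (k + 2)) K) * X 0 ^ e1 * X (Fin.last (k + 1)) =
      monomial (Finsupp.single 0 e1 + Finsupp.single (Fin.last (k + 1)) 1) (3 : K) := by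
    rw [monomial_single_add, ← mul_one (3 : K), ← C_mul_monomial, ← X, map_ofNat]
    ring
  rw [hpoly, polyAct_monomial, prod_ofFn_pow_single_zero_add_single_last, Module.End.mul_apply,
    rad_apply] at hφ0
  obtain ⟨_, ψ, hψ, hψ0, hψj⟩ := three_smul_rad_pow_mem_tameChein (K := K) (i := 0) (a := i1)
    (b := i2) (c := Fin.last (k + 1)) e1 (hne (by simp; omega)) (hne (by simp; omega))
    (hne (by simp)) (hne (by omega)) (hne (by simp; omega)) (hne (by simp; omega))
  have hφψ : φ = ψ := equiv_ext fun j => by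
    by_cases hj : j = 0
    · rw [hj, hφ0, hψ0]
    · rw [hφ j hj, hψj j hj]
  rw [hφψ]
  exact hψ
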